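/- Let α > 1 and β > 1 be real numbers. Then there exists a finite upper bound on the cardinalities of subsets X ⊆ L(α,β) in strictly convex position with conv(X) ∩ L(α,β) = X (i.e., h(L(α,β)) is finite) if and only if log_α(β) is a rational number, i.e., if and only if there exist positive integers p, q with β^q = α^p. -/

import Mathlib

/-- The exponential lattice `L(α) = {α^n : n ∈ ℕ₀}²`. -/
def expLattice (α : ℝ) : Set (ℝ × ℝ) :=
  {p | ∃ m n : ℕ, p = (α ^ m, α ^ n)}

/-- The exponential lattice `L(α,β) = {α^n : n ∈ ℕ₀} × {β^n : n ∈ ℕ₀}`. -/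
def expLattice2 (α β : ℝ) : Set (ℝ × ℝ) :=
  {p | ∃ m n : ℕ, p = (α ^ m, β ^ n)}

/-- A set of points in the plane is in strictly convex position if no point of
the set lies in the convex hull of the other points. -/
def StrictConvexPos (X : Set (ℝ × ℝ)) : Prop :=
  ∀ x ∈ X, x ∉ convexHull ℝ (X \ {x})

/-- `X` is the vertex set of an empty convex polygon in `S`. -/
def IsEmptyPolygonIn (S X : Set (ℝ × ℝ)) : Prop :=
  X ⊆ S ∧ StrictConvexPos X ∧ convexHull ℝ X ∩ S = X

/-- Points `(x i, r i * x i)` with increasing slopes `r i` that do not accumulate too fast lie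
strictly above the line through the `i`-th of them with slope `r (i + 1)`. -/
lemma convex_chain {x r : ℕ → ℝ} (hx : StrictMono x) (hx0 : ∀ i, 0 < x i) (hr : StrictMono r)
    (H : ∀ j, (r (j + 1) - r j) * x j < (r (j + 2) - r (j + 1)) * (x (j + 1) - x j))
    {i j : ℕ} (hij : j ≠ i) : r i * x i + r (i + 1) * (x j - x i) < r j * x j := by
  rcases lt_or_gt_of_ne hij with h | h
  · have step : ∀ l, l < i → (r (i + 1) - r l) * x l < (r (i + 1) - r (l + 1)) * x (l + 1) := by
      intro l hl
      have h1 : r (l + 2) ≤ r (i + 1) := hr.monotone (by omega)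
      have h2 : x l < x (l + 1) := hx (by omega)
      nlinarith [H l, mul_nonneg (sub_nonneg.2 h1) (sub_nonneg.2 h2.le)]
    have key : (r (i + 1) - r j) * x j < (r (i + 1) - r i) * x i := by
      have : ∀ d, j + (d + 1) ≤ i →
          (r (i + 1) - r j) * x j < (r (i + 1) - r (j + (d + 1))) * x (j + (d + 1)) := by
        intro d
        induction d with
        | zero => intro hd; exact step j (by omega)
        | succ d ih => intro hd; exact (ih (by omega)).trans (step _ (by omega))
      have := this (i - j - 1) (by omega)
      rwa [show j + (i - j - 1 + 1) = i by omega] at this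
    linarith
  · have h1 : r (i + 1) ≤ r j := hr.monotone (by omega)
    have h2 : r i < r (i + 1) := hr (by omega)
    nlinarith [hx0 i, hx0 j, mul_pos (hx0 i) (sub_pos.2 h2),
      mul_nonneg (hx0 j).le (sub_nonneg.2 h1)]

lemma convex_setOf_le_linear (a b c : ℝ) : Convex ℝ {p : ℝ × ℝ | c ≤ a * p.1 + b * p.2} :=
  convex_halfSpace_ge (f := fun p : ℝ × ℝ => a * p.1 + b * p.2)
    ⟨fun x y => by simp; ring, fun t x => by simp; ring⟩ c

lemma convex_setOf_lt_linear (a b c : ℝ) : Convex ℝ {p : ℝ × ℝ | c < a * p.1 + b * p.2} :=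
  convex_halfSpace_gt (f := fun p : ℝ × ℝ => a * p.1 + b * p.2)
    ⟨fun x y => by simp; ring, fun t x => by simp; ring⟩ c

/-- The logarithm of the slope of the line joining the origin to `(α ^ m, β ^ n)`. -/
noncomputable def logSlope (α β : ℝ) (m n : ℕ) : ℝ := n * Real.log β - m * Real.log α

lemma exp_logSlope_mul {α β : ℝ} (hα : 1 < α) (hβ : 1 < β) (m n : ℕ) :
    Real.exp (logSlope α β m n) * α ^ m = β ^ n := by
  have h1 : α ^ m = Real.exp (m * Real.log α) := by
    rw [Real.exp_nat_mul, Real.exp_log (by linarith)]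
  have h2 : β ^ n = Real.exp (n * Real.log β) := by
    rw [Real.exp_nat_mul, Real.exp_log (by linarith)]
  rw [h1, h2, ← Real.exp_add, logSlope]
  congr 1; ring

lemma logSlope_swap (α β : ℝ) (m n : ℕ) : logSlope β α n m = -logSlope α β m n := by
  simp [logSlope]

lemma logSlope_mono {α β : ℝ} (hβ : 1 < β) (m : ℕ) : Monotone (logSlope α β m) := fun _ _ h =>
  sub_le_sub_right (mul_le_mul_of_nonneg_right (Nat.cast_le.2 h) (Real.log_pos hβ).le) _

lemma exists_emptyPolygon {α β : ℝ} (hα : 1 < α) (hβ : 1 < β) (k : ℕ) (m n : ℕ → ℕ)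
    (hm : StrictMono m) (hF : StrictMono fun i => logSlope α β (m i) (n i))
    (H : ∀ j, logSlope α β (m (j + 1)) (n (j + 1)) - logSlope α β (m j) (n j) ≤
      (α ^ (m (j + 1) - m j) - 1) *
        (logSlope α β (m (j + 2)) (n (j + 2)) - logSlope α β (m (j + 1)) (n (j + 1))))
    (hE : ∀ i < k, ∀ a b : ℕ, a < m (i + 1) - m i → 0 < logSlope α β a b →
      logSlope α β (m k) (n k) - logSlope α β (m i) (n i) < logSlope α β a b) :
    ∃ X : Set (ℝ × ℝ), X.Finite ∧ IsEmptyPolygonIn (expLattice2 α β) X ∧ X.ncard = k + 1 := by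
  set F : ℕ → ℝ := fun i => logSlope α β (m i) (n i) with hFdef
  set x : ℕ → ℝ := fun i => α ^ m i with hxdef
  set r : ℕ → ℝ := fun i => Real.exp (F i) with hrdef
  have hx : StrictMono x := fun i j hij => pow_lt_pow_right₀ hα (hm hij)
  have hx0 : ∀ i, 0 < x i := fun i => pow_pos (by linarith) _
  have hr : StrictMono r := fun i j hij => Real.exp_lt_exp.2 (hF hij)
  have hr0 : ∀ i, 0 < r i := fun i => Real.exp_pos _
  have hy : ∀ i, r i * x i = β ^ n i := fun i => exp_logSlope_mul hα hβ _ _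
  have hH : ∀ j, (r (j + 1) - r j) * x j < (r (j + 2) - r (j + 1)) * (x (j + 1) - x j) := by
    intro j
    have hu : F j < F (j + 1) := hF (by omega)
    have hu' : F (j + 1) < F (j + 2) := hF (by omega)
    have e1 : r j = r (j + 1) * Real.exp (-(F (j + 1) - F j)) := by
      simp only [hrdef]; rw [← Real.exp_add]; congr 1; ring
    have e2 : r (j + 2) = r (j + 1) * Real.exp (F (j + 2) - F (j + 1)) := by
      simp only [hrdef]; rw [← Real.exp_add]; congr 1; ring
    have e3 : x (j + 1) = α ^ (m (j + 1) - m j) * x j := by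
      simp only [hxdef]; rw [← pow_add]; congr 1
      have := hm (show j < j + 1 by omega); omega
    have i1 := Real.add_one_le_exp (-(F (j + 1) - F j))
    have i2 := Real.add_one_lt_exp (x := F (j + 2) - F (j + 1)) (by linarith)
    have hQ : 0 < α ^ (m (j + 1) - m j) - 1 := by
      have := hx (show j < j + 1 by omega)
      rw [e3] at this
      nlinarith [hx0 j]
    rw [e1, e2, e3]
    have i3 : 1 - Real.exp (-(F (j + 1) - F j)) <
        (Real.exp (F (j + 2) - F (j + 1)) - 1) * (α ^ (m (j + 1) - m j) - 1) :=
      calc _ ≤ F (j + 1) - F j := by linarith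
        _ ≤ (α ^ (m (j + 1) - m j) - 1) * (F (j + 2) - F (j + 1)) := H j
        _ < (α ^ (m (j + 1) - m j) - 1) * (Real.exp (F (j + 2) - F (j + 1)) - 1) := by
            apply mul_lt_mul_of_pos_left _ hQ; linarith
        _ = _ := mul_comm _ _
    have := mul_lt_mul_of_pos_left i3 (mul_pos (hr0 (j + 1)) (hx0 j))
    nlinarith [this]
  have chain : ∀ {i j : ℕ}, j ≠ i → r i * x i + r (i + 1) * (x j - x i) < r j * x j :=
    fun h => convex_chain hx hx0 hr hH h
  set V : ℕ → ℝ × ℝ := fun i => (x i, r i * x i) with hV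
  have hVinj : Function.Injective V := fun i j h => hx.injective (congrArg Prod.fst h)
  refine ⟨V '' Set.Iic k, (Set.finite_Iic k).image V, ⟨?_, ?_, ?_⟩, ?_⟩
  · rintro _ ⟨i, -, rfl⟩
    exact ⟨m i, n i, by simp only [hV, hy]; rfl⟩
  · rintro _ ⟨i, -, rfl⟩ hmem
    have hsub : V '' Set.Iic k \ {V i} ⊆
        {p : ℝ × ℝ | r i * x i - r (i + 1) * x i < (-r (i + 1)) * p.1 + 1 * p.2} := by
      rintro _ ⟨⟨j, -, rfl⟩, hj⟩
      have hji : j ≠ i := fun h => hj (by simp [h])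
      have := chain hji
      simp only [hV, Set.mem_ofPred_eq]
      linarith
    have := convexHull_min hsub (convex_setOf_lt_linear _ _ _) hmem
    simp only [hV, Set.mem_ofPred_eq] at this
    linarith
  · refine Set.Subset.antisymm ?_ fun p hp => ⟨subset_convexHull ℝ _ hp, ?_⟩
    swap
    · obtain ⟨i, -, rfl⟩ := hp
      exact ⟨m i, n i, by simp only [hV, hy]; rfl⟩
    rintro _ ⟨hz, a, b, rfl⟩
    have hlow : x 0 ≤ α ^ a := by
      have hsub : V '' Set.Iic k ⊆ {p : ℝ × ℝ | x 0 ≤ 1 * p.1 + 0 * p.2} := by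
        rintro _ ⟨j, -, rfl⟩
        simpa [hV] using hx.monotone (Nat.zero_le j)
      simpa using convexHull_min hsub (convex_setOf_le_linear _ _ _) hz
    have hhigh : α ^ a ≤ x k := by
      have hsub : V '' Set.Iic k ⊆ {p : ℝ × ℝ | -x k ≤ (-1) * p.1 + 0 * p.2} := by
        rintro _ ⟨j, hj, rfl⟩
        simpa [hV] using hx.monotone hj
      simpa using convexHull_min hsub (convex_setOf_le_linear _ _ _) hz
    have htop : β ^ b ≤ r k * α ^ a := by
      have hsub : V '' Set.Iic k ⊆ {p : ℝ × ℝ | 0 ≤ r k * p.1 + (-1) * p.2} := by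
        rintro _ ⟨j, hj, rfl⟩
        have := mul_le_mul_of_nonneg_right (hr.monotone hj) (hx0 j).le
        simp only [hV, Set.mem_ofPred_eq]; linarith
      have := convexHull_min hsub (convex_setOf_le_linear _ _ _) hz
      simp only [Set.mem_ofPred_eq] at this; linarith
    have hbot : ∀ i, r i * x i + r (i + 1) * (α ^ a - x i) ≤ β ^ b := by
      intro i
      have hsub : V '' Set.Iic k ⊆
          {p : ℝ × ℝ | r i * x i - r (i + 1) * x i ≤ (-r (i + 1)) * p.1 + 1 * p.2} := by
        rintro _ ⟨j, -, rfl⟩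
        simp only [hV, Set.mem_ofPred_eq]
        rcases eq_or_ne j i with rfl | hji
        · linarith
        · linarith [chain hji]
      have := convexHull_min hsub (convex_setOf_le_linear _ _ _) hz
      simp only [Set.mem_ofPred_eq] at this; linarith
    have hlow' : m 0 ≤ a := (pow_le_pow_iff_right₀ hα).1 hlow
    have hhigh' : a ≤ m k := (pow_le_pow_iff_right₀ hα).1 hhigh
    rcases hhigh'.eq_or_lt with rfl | hlt
    · refine ⟨k, Set.mem_Iic.2 le_rfl, ?_⟩
      have := hbot k
      simp only [hxdef, hV, Prod.mk.injEq, true_and] at *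
      linarith
    have hex : ∃ i, a < m (i + 1) := ⟨k, hlt.trans (hm (by omega))⟩
    classical
    obtain ⟨i, hi1, hi2⟩ : ∃ i, m i ≤ a ∧ a < m (i + 1) := by
      refine ⟨Nat.find hex, ?_, Nat.find_spec hex⟩
      rcases Nat.eq_zero_or_pos (Nat.find hex) with h0 | h0
      · rw [h0]; exact hlow'
      · have := Nat.find_min hex (m := Nat.find hex - 1) (by omega)
        rw [Nat.sub_add_cancel h0] at this
        omega
    have hik : i < k := by
      by_contra! h
      have := hm.monotone h
      omega
    have hza := exp_logSlope_mul hα hβ a b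
    have hxa : x i ≤ α ^ a := (pow_le_pow_iff_right₀ hα).2 hi1
    have ha0 : 0 < α ^ a := (hx0 i).trans_le hxa
    have hri : r i < r (i + 1) := hr (by omega)
    have hrle : r i * α ^ a ≤ β ^ b := by
      nlinarith [hbot i, mul_nonneg (sub_nonneg.2 hri.le) (sub_nonneg.2 hxa)]
    have hFle : F i ≤ logSlope α β a b := by
      rw [← hza] at hrle
      exact Real.exp_le_exp.1 (le_of_mul_le_mul_right hrle ha0)
    have hFge : logSlope α β a b ≤ F k := by
      rw [← hza] at htop
      exact Real.exp_le_exp.1 (le_of_mul_le_mul_right htop ha0)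
    have hla : 0 < Real.log α := Real.log_pos hα
    have hlb : 0 < Real.log β := Real.log_pos hβ
    have hnb : n i ≤ b := by
      have h1 : (m i : ℝ) ≤ a := by exact_mod_cast hi1
      have h2 := mul_le_mul_of_nonneg_right h1 hla.le
      simp only [hFdef, logSlope] at hFle
      have : (n i : ℝ) * Real.log β ≤ b * Real.log β := by linarith
      exact_mod_cast le_of_mul_le_mul_right this hlb
    have hsub : logSlope α β (a - m i) (b - n i) = logSlope α β a b - F i := by
      simp only [hFdef, logSlope, Nat.cast_sub hi1, Nat.cast_sub hnb]; ring
    have hE' := hE i hik (a - m i) (b - n i) (by omega)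
    rw [hsub] at hE'
    have heq : logSlope α β a b = F i := by
      by_contra hne
      have := hE' (sub_pos.2 (lt_of_le_of_ne hFle (Ne.symm hne)))
      simp only [hFdef] at hFge this
      linarith
    have hb : β ^ b = r i * α ^ a := by rw [← hza, heq]
    have hxe : α ^ a = x i := by
      have := hbot i
      rw [hb] at this
      nlinarith
    exact ⟨i, Set.mem_Iic.2 hik.le, by simp only [hV, hb, hxe]⟩
  · rw [Set.ncard_image_of_injective _ hVinj, ← Finset.coe_Iic, Set.ncard_coe_finset, Nat.card_Iic]

lemma IsEmptyPolygonIn.swap {α β : ℝ} {X : Set (ℝ × ℝ)}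
    (h : IsEmptyPolygonIn (expLattice2 β α) X) :
    IsEmptyPolygonIn (expLattice2 α β) (Prod.swap '' X) := by
  have hconv : ∀ Y : Set (ℝ × ℝ), convexHull ℝ (Prod.swap '' Y) = Prod.swap '' convexHull ℝ Y :=
    fun Y => ((LinearEquiv.prodComm ℝ ℝ ℝ).toLinearMap.image_convexHull Y).symm
  have hinj : Function.Injective (Prod.swap : ℝ × ℝ → ℝ × ℝ) := Prod.swap_injective
  have hL : expLattice2 α β = Prod.swap '' expLattice2 β α := by
    ext p
    constructor
    · rintro ⟨m, n, rfl⟩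
      exact ⟨_, ⟨n, m, rfl⟩, rfl⟩
    · rintro ⟨_, ⟨n, m, rfl⟩, rfl⟩
      exact ⟨m, n, rfl⟩
  obtain ⟨h1, h2, h3⟩ := h
  refine ⟨hL ▸ Set.image_mono h1, ?_, ?_⟩
  · rintro _ ⟨x, hx, rfl⟩
    rw [← Set.image_singleton, ← Set.image_sdiff hinj, hconv, hinj.mem_set_image]
    exact h2 x hx
  · rw [hL, hconv, ← Set.image_inter hinj, h3]

/-- If empty polygons have at most `K` vertices, then no lattice vector approximates the diagonal
from above much better than all previous ones. -/
lemma exists_logSlope_le_mul {α β : ℝ} (hα : 1 < α) (hβ : 1 < β) {K : ℕ}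
    (hN : ∀ X : Set (ℝ × ℝ), X.Finite → IsEmptyPolygonIn (expLattice2 α β) X → X.ncard ≤ K)
    {m n : ℕ} (h0 : 0 < logSlope α β m n) (h2 : 2 ≤ α ^ m) :
    ∃ a b : ℕ, a < m ∧ 0 < logSlope α β a b ∧ logSlope α β a b ≤ K * logSlope α β m n := by
  by_contra! hcon
  have hm0 : 0 < m := by
    rcases Nat.eq_zero_or_pos m with rfl | h
    · norm_num at h2
    · exact h
  have hmul : ∀ i : ℕ, logSlope α β (i * m) (i * n) = i * logSlope α β m n := by
    intro i; simp only [logSlope]; push_cast; ring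
  have hsub : ∀ i : ℕ, (i + 1) * m - i * m = m := by
    intro i; rw [add_mul, one_mul, Nat.add_sub_cancel_left]
  obtain ⟨X, hX, hX', hc⟩ := exists_emptyPolygon hα hβ K (fun i => i * m) (fun i => i * n)
    (fun i j hij => Nat.mul_lt_mul_of_pos_right hij hm0)
    (fun i j hij => by
      have : (i : ℝ) < j := by exact_mod_cast hij
      simp only [hmul]; exact mul_lt_mul_of_pos_right this h0)
    (fun j => by
      simp only [hmul, hsub]; push_cast; nlinarith)
    (fun i hi a b ha hab => by
      simp only [hsub] at ha
      have := hcon a b ha hab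
      have hi0 : (0 : ℝ) ≤ i := by positivity
      simp only [hmul]; nlinarith)
  have := hN X hX hX'
  omega

lemma exists_le_logSlope {α β : ℝ} (hβ : 1 < β) (M : ℕ) :
    ∃ ε : ℝ, 0 < ε ∧ ∀ m n : ℕ, m < M → 0 < logSlope α β m n → ε ≤ logSlope α β m n := by
  induction M with
  | zero => exact ⟨1, one_pos, fun m n h => absurd h (Nat.not_lt_zero _)⟩
  | succ M ih =>
    obtain ⟨ε, hε, h⟩ := ih
    by_cases hex : ∃ n, 0 < logSlope α β M n
    · classical
      refine ⟨min ε (logSlope α β M (Nat.find hex)), lt_min hε (Nat.find_spec hex), ?_⟩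
      intro m n hm hpos
      rcases Nat.lt_succ_iff_lt_or_eq.1 hm with hm | rfl
      · exact (min_le_left _ _).trans (h m n hm hpos)
      · exact (min_le_right _ _).trans (logSlope_mono hβ _ (Nat.find_min' hex hpos))
    · refine ⟨ε, hε, fun m n hm hpos => ?_⟩
      rcases Nat.lt_succ_iff_lt_or_eq.1 hm with hm | rfl
      · exact h m n hm hpos
      · exact absurd ⟨n, hpos⟩ hex

/-- A lattice vector of least positive slope among those with first exponent less than `M`. -/
lemma exists_min_logSlope {α β : ℝ} (hβ : 1 < β) {M : ℕ} (hM : 0 < M) :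
    ∃ a b : ℕ, a < M ∧ 0 < logSlope α β a b ∧
      ∀ m n : ℕ, m < M → 0 < logSlope α β m n → logSlope α β a b ≤ logSlope α β m n := by
  have hlb : 0 < Real.log β := Real.log_pos hβ
  have hex : ∀ m : ℕ, ∃ n : ℕ, 0 < logSlope α β m n := by
    intro m
    obtain ⟨n, hn⟩ := exists_nat_gt (m * Real.log α / Real.log β)
    exact ⟨n, by rw [div_lt_iff₀ hlb] at hn; simp only [logSlope]; linarith⟩
  classical
  obtain ⟨a, ha, hmin⟩ := Finset.exists_min_image (Finset.range M)
    (fun m => logSlope α β m (Nat.find (hex m))) ⟨0, Finset.mem_range.2 hM⟩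
  refine ⟨a, Nat.find (hex a), Finset.mem_range.1 ha, Nat.find_spec (hex a), ?_⟩
  intro m n hm hpos
  exact (hmin m (Finset.mem_range.2 hm)).trans
    (logSlope_mono hβ _ (Nat.find_min' (hex m) hpos))

lemma exists_logSlope_lt {α β : ℝ} (hα : 1 < α) (hβ : 1 < β)
    (hirr : ¬ ∃ p q : ℕ, 0 < p ∧ 0 < q ∧ β ^ q = α ^ p) {ε : ℝ} (hε : 0 < ε) :
    ∃ m n : ℕ, 0 < logSlope α β m n ∧ logSlope α β m n < ε := by
  have hla : 0 < Real.log α := Real.log_pos hα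
  have hlb : 0 < Real.log β := Real.log_pos hβ
  have hne : ∀ m n : ℕ, 0 < m → logSlope α β m n ≠ 0 := by
    intro m n hm h0
    have h1 := exp_logSlope_mul hα hβ m n
    rw [h0, Real.exp_zero, one_mul] at h1
    refine hirr ⟨m, n, hm, ?_, h1.symm⟩
    rcases Nat.eq_zero_or_pos n with rfl | hn
    · have := one_lt_pow₀ hα hm.ne'
      rw [h1, pow_zero] at this
      exact absurd this (lt_irrefl _)
    · exact hn
  obtain ⟨N, hN⟩ := exists_nat_gt (Real.log β / ε)
  have hN0 : 0 < N := by
    have : (0 : ℝ) < N := (by positivity : 0 < Real.log β / ε).trans hN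
    exact_mod_cast this
  obtain ⟨j, k, hk0, hkN, hjk⟩ :=
    Real.exists_int_int_abs_mul_sub_le (Real.log α / Real.log β) hN0
  have hxi : 0 < Real.log α / Real.log β := by positivity
  have hj0 : 0 ≤ j := by
    by_contra! hj
    have h1 : (j : ℝ) ≤ -1 := by exact_mod_cast (by omega : j ≤ -1)
    have h2 : (1 : ℝ) ≤ k := by exact_mod_cast hk0
    have h3 := le_abs_self ((k : ℝ) * (Real.log α / Real.log β) - j)
    have h4 : (1 : ℝ) / (N + 1) < 1 := by
      rw [div_lt_one (by positivity)]
      have : (0 : ℝ) < N := by exact_mod_cast hN0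
      linarith
    have h5 : 0 < (k : ℝ) * (Real.log α / Real.log β) := by positivity
    linarith
  lift j to ℕ using hj0
  lift k to ℕ using hk0.le
  have hk0' : 0 < k := by exact_mod_cast hk0
  have hbound : |logSlope α β k j| < ε := by
    have e : logSlope α β k j =
        -(((k : ℤ) : ℝ) * (Real.log α / Real.log β) - ((j : ℤ) : ℝ)) * Real.log β := by
      simp only [logSlope, Int.cast_natCast]; field_simp; ring
    rw [e, abs_mul, abs_neg, abs_of_pos hlb]
    rw [div_lt_iff₀ hε] at hN
    have h1 : (0 : ℝ) < (N : ℝ) + 1 := by positivity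
    calc _ ≤ 1 / ((N : ℝ) + 1) * Real.log β := mul_le_mul_of_nonneg_right hjk hlb.le
      _ = Real.log β / (N + 1) := by ring
      _ < ε := by rw [div_lt_iff₀ h1]; nlinarith
  rcases lt_or_gt_of_ne (hne k j hk0') with hneg | hpos
  · set δ := -logSlope α β k j with hδ
    have hδ0 : 0 < δ := by linarith
    have hδε : δ < ε := by rw [abs_of_neg hneg] at hbound; exact hbound
    have hle := Nat.floor_le (a := Real.log β / δ) (by positivity)
    have hlt := Nat.lt_floor_add_one (Real.log β / δ)
    rw [le_div_iff₀ hδ0] at hle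
    rw [div_lt_iff₀ hδ0] at hlt
    set l := ⌊Real.log β / δ⌋₊
    have e : logSlope α β (l * k) (l * j + 1) = Real.log β - l * δ := by
      simp only [hδ, logSlope]; push_cast; ring
    rcases Nat.eq_zero_or_pos l with hl | hl
    · refine ⟨l * k, l * j + 1, ?_, ?_⟩ <;> rw [e] <;> simp only [hl] at * <;> push_cast at * <;>
        linarith
    · refine ⟨l * k, l * j + 1, lt_of_le_of_ne ?_ (hne _ _ (Nat.mul_pos hl hk0')).symm, ?_⟩ <;>
        rw [e] <;> linarith
  · exact ⟨k, j, hpos, by rwa [abs_of_pos hpos] at hbound⟩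

/-- At every small scale `ε` there is a vector of slope comparable to `ε` and smaller by a definite
factor than all positive slopes of vectors with smaller first exponent. -/
lemma exists_gap {α β : ℝ} (hα : 1 < α) (hβ : 1 < β)
    (hirr : ¬ ∃ p q : ℕ, 0 < p ∧ 0 < q ∧ β ^ q = α ^ p) {K : ℕ} (hK : 0 < K)
    (hN : ∀ X : Set (ℝ × ℝ), X.Finite → IsEmptyPolygonIn (expLattice2 α β) X → X.ncard ≤ K)
    (M : ℕ) :
    ∃ ε₀ : ℝ, 0 < ε₀ ∧ ∀ ε, 0 < ε → ε ≤ ε₀ → ∃ m n : ℕ, M ≤ m ∧ 0 < m ∧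
      ε ≤ K * logSlope α β m n ∧ logSlope α β m n < ε ∧
      ∀ a b : ℕ, a < m → 0 < logSlope α β a b →
        (K + 1) * logSlope α β m n ≤ K * logSlope α β a b := by
  have hla : 0 < Real.log α := Real.log_pos hα
  have hlb : 0 < Real.log β := Real.log_pos hβ
  have hN' : ∀ X : Set (ℝ × ℝ), X.Finite → IsEmptyPolygonIn (expLattice2 β α) X →
      X.ncard ≤ K := by
    intro X hX hX'
    have := hN _ (hX.image _) hX'.swap
    rwa [Set.ncard_image_of_injective _ Prod.swap_injective] at this
  have hK0 : (0 : ℝ) < K := by exact_mod_cast hK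
  obtain ⟨A, hA⟩ := pow_unbounded_of_one_lt 2 hα
  obtain ⟨B, hB⟩ := pow_unbounded_of_one_lt 2 hβ
  obtain ⟨ε₁, hε₁, h₁⟩ := exists_le_logSlope (α := α) hβ (M + A + 1)
  obtain ⟨ε₂, hε₂, h₂⟩ := exists_le_logSlope (α := β) hα B
  refine ⟨min ε₁ (min (ε₂ / K) (Real.log β / K)), by positivity, ?_⟩
  intro ε hε hle
  have hle₁ : ε ≤ ε₁ := hle.trans (min_le_left _ _)
  have hle₂ : K * ε ≤ ε₂ := by
    have := hle.trans ((min_le_right _ _).trans (min_le_left _ _))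
    rw [le_div_iff₀ hK0] at this; linarith
  have hle₃ : K * ε ≤ Real.log β := by
    have := hle.trans ((min_le_right _ _).trans (min_le_right _ _))
    rw [le_div_iff₀ hK0] at this; linarith
  classical
  have hex : ∃ m n : ℕ, 0 < logSlope α β m n ∧ logSlope α β m n < ε :=
    exists_logSlope_lt hα hβ hirr hε
  set m := Nat.find hex with hm
  obtain ⟨n, hpos, hlt⟩ : ∃ n : ℕ, 0 < logSlope α β m n ∧ logSlope α β m n < ε := Nat.find_spec hex
  have hmbig : M + A + 1 ≤ m := by
    by_contra! h
    have := h₁ m n h hpos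
    linarith
  obtain ⟨t, s, htm, htpos, htmin⟩ := exists_min_logSlope (α := α) hβ (show 0 < m by omega)
  have htε : ε ≤ logSlope α β t s := by
    by_contra! h
    exact Nat.find_min hex htm ⟨s, htpos, h⟩
  have htK : logSlope α β t s ≤ K * logSlope α β m n := by
    have h2 : 2 ≤ α ^ m := hA.le.trans (pow_le_pow_right₀ hα.le (by omega))
    obtain ⟨a, b, ham, hab, hle⟩ := exists_logSlope_le_mul hα hβ hN hpos h2
    exact (htmin a b ham hab).trans hle
  refine ⟨m, n, by omega, by omega, by linarith, hlt, ?_⟩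
  suffices hgap : logSlope α β t s ≤ K * (logSlope α β t s - logSlope α β m n) by
    intro a b ha hab
    have := htmin a b ha hab
    nlinarith
  by_contra! hcon
  have hsn : s ≤ n := by
    by_contra! h
    have h1 : ((n : ℝ)) + 1 ≤ s := by exact_mod_cast h
    have h2 : ((t : ℝ)) ≤ m := by exact_mod_cast htm.le
    have h3 : Real.log β < logSlope α β t s := by
      have : logSlope α β t s = logSlope α β m n + (s - n) * Real.log β + (m - t) * Real.log α := by
        simp only [logSlope]; ring
      nlinarith [mul_nonneg (sub_nonneg.2 h2) hla.le]
    nlinarith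
  set δ := logSlope α β t s - logSlope α β m n with hδ
  have hδ0 : 0 < δ := by linarith
  have ediff : logSlope β α (n - s) (m - t) = δ := by
    simp only [hδ, logSlope, Nat.cast_sub hsn, Nat.cast_sub htm.le]; ring
  have hB' : B ≤ n - s := by
    by_contra! h
    have := h₂ (n - s) (m - t) h (by rw [ediff]; exact hδ0)
    rw [ediff] at this
    nlinarith
  have h2 : 2 ≤ β ^ (n - s) := hB.le.trans (pow_le_pow_right₀ hβ.le hB')
  obtain ⟨b, a, hb, hab, hle⟩ :=
    exists_logSlope_le_mul hβ hα hN' (by rw [ediff]; exact hδ0) h2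
  rw [ediff] at hle
  rw [logSlope_swap] at hab hle
  have hat : a < m - t := by
    have h1 : ((b : ℝ)) + 1 ≤ ((n - s : ℕ) : ℝ) := by exact_mod_cast hb
    have h4 : (a : ℝ) * Real.log α < ((m - t : ℕ) : ℝ) * Real.log α := by
      simp only [logSlope] at hle ediff
      nlinarith
    exact_mod_cast lt_of_mul_lt_mul_right h4 hla.le
  have eadd : logSlope α β (t + a) (s + b) = logSlope α β t s + logSlope α β a b := by
    simp only [logSlope]; push_cast; ring
  have := htmin (t + a) (s + b) (by omega) (by rw [eadd]; linarith)
  rw [eadd] at this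
  linarith

lemma exists_of_ncard_le {α β : ℝ} (hα : 1 < α) (hβ : 1 < β) {N : ℕ}
    (hN : ∀ X : Set (ℝ × ℝ), X.Finite → IsEmptyPolygonIn (expLattice2 α β) X → X.ncard ≤ N) :
    ∃ p q : ℕ, 0 < p ∧ 0 < q ∧ β ^ q = α ^ p := by
  by_contra hirr
  set K := N + 1
  have hN' : ∀ X : Set (ℝ × ℝ), X.Finite → IsEmptyPolygonIn (expLattice2 α β) X →
      X.ncard ≤ K := fun X h h' => (hN X h h').trans (by omega)
  have hK1 : (1 : ℝ) ≤ K := by exact_mod_cast (by omega : 1 ≤ K)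
  set C : ℝ := 2 * K ^ 2 with hC
  have hC2 : 2 ≤ C := by nlinarith
  obtain ⟨M, hM⟩ := pow_unbounded_of_one_lt (C * K + 1) hα
  obtain ⟨ε₀, hε₀, h⟩ := exists_gap hα hβ hirr (show 0 < K by omega) hN' M
  set e : ℕ → ℝ := fun i => ε₀ / C ^ i with he
  have he0 : ∀ i, 0 < e i := fun i => by positivity
  have hle : ∀ i, e i ≤ ε₀ := fun i => div_le_self hε₀.le (one_le_pow₀ (by linarith))
  have heC : ∀ i, e i = C * e (i + 1) := by
    intro i; simp only [he, pow_succ]; field_simp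
  choose m n hMm hm0 hlow hhigh hgap using fun i => h (e i) (he0 i) (hle i)
  set f : ℕ → ℝ := fun i => logSlope α β (m i) (n i) with hf
  set m' : ℕ → ℕ := fun i => ∑ l ∈ Finset.range i, m l with hm'
  set n' : ℕ → ℕ := fun i => ∑ l ∈ Finset.range i, n l with hn'
  have hf0 : ∀ i, 0 < f i := fun i => by
    have := (he0 i).trans_le (hlow i)
    exact pos_of_mul_pos_right this (by linarith)
  have hstep : ∀ i, m' (i + 1) - m' i = m i := fun i => by
    simp only [hm', Finset.sum_range_succ, Nat.add_sub_cancel_left]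
  have hF : ∀ i, logSlope α β (m' (i + 1)) (n' (i + 1)) = logSlope α β (m' i) (n' i) + f i := by
    intro i
    simp only [hm', hn', hf, logSlope, Finset.sum_range_succ]; push_cast; ring
  have hanti : Antitone fun i => logSlope α β (m' i) (n' i) + 2 * e i := by
    refine antitone_nat_of_succ_le fun i => ?_
    rw [hF]
    have h1 : f i < e i := hhigh i
    have h2 := heC i
    nlinarith [he0 (i + 1)]
  obtain ⟨X, hX, hX', hc⟩ := exists_emptyPolygon hα hβ K m' n'
    (strictMono_nat_of_lt_succ fun i => by
      simp only [hm', Finset.sum_range_succ]; exact Nat.lt_add_of_pos_right (hm0 i))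
    (strictMono_nat_of_lt_succ fun i => by rw [hF]; linarith [hf0 i])
    (fun j => by
      rw [hstep, hF (j + 1), hF j]
      have h1 : f j < e j := hhigh j
      have h2 : e (j + 1) ≤ K * f (j + 1) := hlow (j + 1)
      have h3 : C * K + 1 ≤ α ^ m j := hM.le.trans (pow_le_pow_right₀ hα.le (hMm j))
      have h4 := heC j
      have h5 : C * e (j + 1) ≤ C * (K * f (j + 1)) :=
        mul_le_mul_of_nonneg_left h2 (by linarith)
      have h6 := mul_le_mul_of_nonneg_right h3 (hf0 (j + 1)).le
      linarith)
    (fun i hi a b ha hab => by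
      rw [hstep] at ha
      have h1 : (K + 1) * f i ≤ K * logSlope α β a b := hgap i a b ha hab
      have h2 := hanti (show i + 1 ≤ K by omega)
      simp only [hF i] at h2
      have h3 : e i ≤ K * f i := hlow i
      have h4 := heC i
      have h5 : 2 * e (i + 1) * K ≤ f i := by
        have : K * (2 * e (i + 1) * K) ≤ K * f i := by
          calc _ = e i := by rw [h4, hC]; ring
            _ ≤ _ := h3
        exact le_of_mul_le_mul_left this (by linarith)
      have h6 : K * (logSlope α β (m' K) (n' K) - logSlope α β (m' i) (n' i)) <
          K * logSlope α β a b := by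
        nlinarith [he0 K]
      exact lt_of_mul_lt_mul_left h6 (by linarith))
  have := hN X hX hX'
  omega

/-- No lattice point with exponents `z` lies in a triangle spanned by other points of `A`. -/
def NoTriangle (γ : ℝ) (A : Finset (ℕ × ℕ)) : Prop :=
  ∀ z, ∀ P ∈ A, ∀ Q ∈ A, ∀ R ∈ A, P ≠ z → Q ≠ z → R ≠ z → ∀ a b c : ℝ,
    0 ≤ a → 0 ≤ b → 0 ≤ c → a + b + c = 1 →
    a * γ ^ P.1 + b * γ ^ Q.1 + c * γ ^ R.1 = γ ^ z.1 →
    a * γ ^ P.2 + b * γ ^ Q.2 + c * γ ^ R.2 = γ ^ z.2 → False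

lemma NoTriangle.swap {γ : ℝ} {A : Finset (ℕ × ℕ)} (h : NoTriangle γ A) :
    NoTriangle γ (A.image Prod.swap) := by
  intro z P hP Q hQ R hR hPz hQz hRz a b c ha hb hc habc h1 h2
  simp only [Finset.mem_image] at hP hQ hR
  obtain ⟨P, hP, rfl⟩ := hP
  obtain ⟨Q, hQ, rfl⟩ := hQ
  obtain ⟨R, hR, rfl⟩ := hR
  exact h z.swap P hP Q hQ R hR (fun e => hPz (by simp [e])) (fun e => hQz (by simp [e]))
    (fun e => hRz (by simp [e])) a b c ha hb hc habc h2 h1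

lemma exists_weights_two {x₁ x₂ x₃ : ℝ} (h : x₂ ∈ Set.Icc x₁ x₃) :
    ∃ a c : ℝ, 0 ≤ a ∧ 0 ≤ c ∧ a + c = 1 ∧ a * x₁ + c * x₃ = x₂ := by
  rw [← segment_eq_Icc (h.1.trans h.2)] at h
  obtain ⟨a, c, ha, hc, hac, e⟩ := h
  exact ⟨a, c, ha, hc, hac, by simpa using e⟩

/-- The part of the vertical line through the middle vertex `(x₂, y₂)` of a triangle up to the
opposite side is contained in the triangle. -/
lemma exists_weights {x₁ x₂ x₃ y₁ y₂ y₃ y : ℝ} (h₁₂ : x₁ < x₂) (h₂₃ : x₂ < x₃)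
    (hy : y ∈ Set.uIcc y₂ ((y₁ * (x₃ - x₂) + y₃ * (x₂ - x₁)) / (x₃ - x₁))) :
    ∃ a b c : ℝ, 0 ≤ a ∧ 0 ≤ b ∧ 0 ≤ c ∧ a + b + c = 1 ∧
      a * x₁ + b * x₂ + c * x₃ = x₂ ∧ a * y₁ + b * y₂ + c * y₃ = y := by
  rw [← segment_eq_uIcc] at hy
  obtain ⟨s, t, hs, ht, hst, e⟩ := hy
  have h₁₃ : 0 < x₃ - x₁ := by linarith
  have hne := h₁₃.ne'
  obtain rfl : s = 1 - t := by linarith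
  refine ⟨t * ((x₃ - x₂) / (x₃ - x₁)), 1 - t, t * ((x₂ - x₁) / (x₃ - x₁)),
    mul_nonneg ht (div_nonneg (by linarith) h₁₃.le), hs,
    mul_nonneg ht (div_nonneg (by linarith) h₁₃.le), ?_, ?_, ?_⟩
  · field_simp; ring
  · field_simp; ring
  · rw [← e]; simp only [smul_eq_mul]; field_simp; ring

section

variable {γ : ℝ} {A : Finset (ℕ × ℕ)}

lemma NoTriangle.collinear (hγ : 2 ≤ γ) (h : NoTriangle γ A) {P Q R : ℕ × ℕ} (hP : P ∈ A)
    (hR : R ∈ A) (h₁ : P.1 < Q.1) (h₂ : Q.1 < R.1)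
    (e₁ : P.2 + Q.1 = Q.2 + P.1) (e₂ : Q.2 + R.1 = R.2 + Q.1) : False := by
  have hγ0 : 0 < γ := by linarith
  have hγ1 : 1 ≤ γ := by linarith
  obtain ⟨a, c, ha, hc, hac, e⟩ := exists_weights_two (x₂ := γ ^ Q.1)
    ⟨pow_le_pow_right₀ hγ1 h₁.le, pow_le_pow_right₀ hγ1 h₂.le⟩
  refine h Q P hP P hP R hR (fun e => by simp [e] at h₁) (fun e => by simp [e] at h₁)
    (fun e => by simp [e] at h₂) a 0 c ha le_rfl hc (by linarith) (by linarith) ?_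
  have e1 : γ ^ P.2 * γ ^ Q.1 = γ ^ Q.2 * γ ^ P.1 := by rw [← pow_add, ← pow_add, e₁]
  have e2 : γ ^ Q.2 * γ ^ R.1 = γ ^ R.2 * γ ^ Q.1 := by rw [← pow_add, ← pow_add, e₂]
  apply mul_right_cancel₀ (pow_pos hγ0 Q.1).ne'
  linear_combination a * e1 - c * e2 + γ ^ Q.2 * e

lemma NoTriangle.column (hγ : 2 ≤ γ) (h : NoTriangle γ A) {P Q R : ℕ × ℕ} (hP : P ∈ A)
    (hR : R ∈ A) (e₁ : P.1 = Q.1) (e₂ : Q.1 = R.1)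
    (h₁ : P.2 < Q.2) (h₂ : Q.2 < R.2) : False := by
  have hγ1 : 1 ≤ γ := by linarith
  obtain ⟨a, c, ha, hc, hac, e⟩ := exists_weights_two (x₂ := γ ^ Q.2)
    ⟨pow_le_pow_right₀ hγ1 h₁.le, pow_le_pow_right₀ hγ1 h₂.le⟩
  refine h Q P hP P hP R hR (fun e => by simp [e] at h₁) (fun e => by simp [e] at h₁)
    (fun e => by simp [e] at h₂) a 0 c ha le_rfl hc (by linarith) ?_ (by linarith)
  rw [e₁, ← e₂]
  linear_combination γ ^ Q.1 * hac

lemma NoTriangle.decreasing (hγ : 2 ≤ γ) (h : NoTriangle γ A) {P Q R : ℕ × ℕ} (hP : P ∈ A)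
    (hQ : Q ∈ A) (hR : R ∈ A) (h₁ : P.1 < Q.1) (h₂ : Q.1 < R.1) (h₃ : Q.2 < P.2) :
    P.2 = Q.2 + 1 := by
  by_contra hne
  have hγ0 : 0 < γ := by linarith
  have hγ1 : 1 < γ := by linarith
  have hx₁ := pow_pos hγ0 P.1
  have hx₁₂ : γ ^ P.1 < γ ^ Q.1 := pow_lt_pow_right₀ hγ1 h₁
  have hx₂₃ : γ ^ Q.1 < γ ^ R.1 := pow_lt_pow_right₀ hγ1 h₂
  have hx₃ : γ * γ ^ Q.1 ≤ γ ^ R.1 := by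
    rw [← pow_succ']; exact pow_le_pow_right₀ hγ1.le h₂
  have hy₁ : γ ^ P.2 = γ * γ ^ (P.2 - 1) := by rw [← pow_succ']; congr 1; omega
  have hy : γ ^ Q.2 ≤ γ ^ (P.2 - 1) := pow_le_pow_right₀ hγ1.le (by omega)
  have hy0 := pow_pos hγ0 (P.2 - 1)
  have hy₃ := pow_pos hγ0 R.2
  obtain ⟨a, b, c, ha, hb, hc, habc, e1, e2⟩ :=
    exists_weights (y₁ := γ ^ P.2) (y₂ := γ ^ Q.2) (y₃ := γ ^ R.2) (y := γ ^ (P.2 - 1)) hx₁₂ hx₂₃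
      (Set.mem_uIcc_of_le hy (by
        rw [le_div_iff₀ (by linarith), hy₁]
        have h4 : γ ^ R.1 - γ ^ P.1 ≤ γ * (γ ^ R.1 - γ ^ Q.1) := by nlinarith
        nlinarith [mul_le_mul_of_nonneg_left h4 hy0.le,
          mul_pos hy₃ (sub_pos.2 hx₁₂)]))
  refine h (Q.1, P.2 - 1) P hP Q hQ R hR (fun e => ?_) (fun e => ?_) (fun e => ?_) a b c ha hb hc
    habc e1 e2
  · have := congrArg Prod.fst e; simp at this; omega
  · have := congrArg Prod.snd e; simp at this; omega
  · have := congrArg Prod.fst e; simp at this; omega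

lemma NoTriangle.increasing (hγ : 2 ≤ γ) (h : NoTriangle γ A) {P Q R : ℕ × ℕ} (hP : P ∈ A)
    (hQ : Q ∈ A) (hR : R ∈ A) (h₁ : P.1 < Q.1) (h₂ : Q.1 < R.1) (h₃ : P.2 + 2 ≤ Q.2) :
    Q.2 + R.1 < R.2 + Q.1 + 2 := by
  by_contra! hle
  have hγ0 : 0 < γ := by linarith
  have hγ1 : 1 < γ := by linarith
  have hx₁ := pow_pos hγ0 P.1
  have hx₂ := pow_pos hγ0 Q.1
  have hx₁₂ : γ ^ P.1 < γ ^ Q.1 := pow_lt_pow_right₀ hγ1 h₁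
  have hx₂₃ : γ ^ Q.1 < γ ^ R.1 := pow_lt_pow_right₀ hγ1 h₂
  have hu0 := pow_pos hγ0 (Q.2 - 2)
  have hy₁ : γ ^ P.2 ≤ γ ^ (Q.2 - 2) := pow_le_pow_right₀ hγ1.le (by omega)
  have hy : γ ^ (Q.2 - 1) = γ * γ ^ (Q.2 - 2) := by rw [← pow_succ']; congr 1; omega
  have hy₃ : γ ^ R.2 * γ ^ Q.1 ≤ γ ^ (Q.2 - 2) * γ ^ R.1 := by
    rw [← pow_add, ← pow_add]; exact pow_le_pow_right₀ hγ1.le (by omega)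
  obtain ⟨a, b, c, ha, hb, hc, habc, e1, e2⟩ :=
    exists_weights (y₁ := γ ^ P.2) (y₂ := γ ^ Q.2) (y₃ := γ ^ R.2) (y := γ ^ (Q.2 - 1)) hx₁₂ hx₂₃
      (Set.mem_uIcc_of_ge (by
        rw [div_le_iff₀ (by linarith), hy]
        generalize γ ^ (Q.2 - 2) = u at *
        generalize γ ^ P.1 = x₁ at *
        generalize γ ^ Q.1 = x₂ at *
        generalize γ ^ R.1 = x₃ at *
        generalize γ ^ R.2 = y₃ at *
        have h4 : y₃ * (x₂ - x₁) ≤ u * (x₃ - x₁) := by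
          apply le_of_mul_le_mul_right _ hx₂
          calc y₃ * (x₂ - x₁) * x₂ = (y₃ * x₂) * (x₂ - x₁) := by ring
            _ ≤ (u * x₃) * (x₂ - x₁) := mul_le_mul_of_nonneg_right hy₃ (by linarith)
            _ ≤ u * (x₃ - x₁) * x₂ := by
                nlinarith [mul_nonneg (mul_nonneg hu0.le hx₁.le) (sub_nonneg.2 hx₂₃.le)]
        have h5 := mul_le_mul_of_nonneg_right hy₁ (show 0 ≤ x₃ - x₂ by linarith)
        have h6 := mul_le_mul_of_nonneg_right hγ
          (mul_nonneg hu0.le (show 0 ≤ x₃ - x₁ by linarith))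
        nlinarith [mul_nonneg hu0.le (sub_nonneg.2 hx₁₂.le)])
        (pow_le_pow_right₀ hγ1.le (by omega)))
  refine h (Q.1, Q.2 - 1) P hP Q hQ R hR (fun e => ?_) (fun e => ?_) (fun e => ?_) a b c ha hb hc
    habc e1 e2
  · have := congrArg Prod.fst e; simp at this; omega
  · have := congrArg Prod.snd e; simp at this; omega
  · have := congrArg Prod.fst e; simp at this; omega

lemma NoTriangle.row (hγ : 2 ≤ γ) (h : NoTriangle γ A) {P Q R : ℕ × ℕ} (hP : P ∈ A)
    (hR : R ∈ A) (e₁ : P.2 = Q.2) (e₂ : Q.2 = R.2)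
    (h₁ : P.1 < Q.1) (h₂ : Q.1 < R.1) : False :=
  h.swap.column hγ (P := P.swap) (Q := Q.swap) (Finset.mem_image_of_mem _ hP)
    (Finset.mem_image_of_mem _ hR) e₁ e₂ h₁ h₂

lemma NoTriangle.decreasing' (hγ : 2 ≤ γ) (h : NoTriangle γ A) {P Q R : ℕ × ℕ} (hP : P ∈ A)
    (hQ : Q ∈ A) (hR : R ∈ A) (h₁ : Q.2 < P.2) (h₂ : R.2 < Q.2) (h₃ : Q.1 < R.1) :
    R.1 = Q.1 + 1 :=
  h.swap.decreasing hγ (Finset.mem_image_of_mem Prod.swap hR)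
    (Finset.mem_image_of_mem Prod.swap hQ) (Finset.mem_image_of_mem Prod.swap hP) h₂ h₁ h₃

lemma NoTriangle.increasing' (hγ : 2 ≤ γ) (h : NoTriangle γ A) {P Q R : ℕ × ℕ} (hP : P ∈ A)
    (hQ : Q ∈ A) (hR : R ∈ A) (h₁ : P.2 < Q.2) (h₂ : Q.2 < R.2) (h₃ : P.1 + 2 ≤ Q.1) :
    Q.1 + R.2 < R.1 + Q.2 + 2 :=
  h.swap.increasing hγ (Finset.mem_image_of_mem Prod.swap hP)
    (Finset.mem_image_of_mem Prod.swap hQ) (Finset.mem_image_of_mem Prod.swap hR) h₁ h₂ h₃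

lemma NoTriangle.card_antichain_le (hγ : 2 ≤ γ) (h : NoTriangle γ A) {T : Finset (ℕ × ℕ)}
    (hT : T ⊆ A) (hanti : IsAntichain (· ≤ ·) (T : Set (ℕ × ℕ))) : T.card ≤ 3 := by
  by_contra! hcard
  have hinj : Set.InjOn Prod.fst (T : Set (ℕ × ℕ)) := by
    intro P hP Q hQ hPQ
    by_contra hne
    rcases le_total P.2 Q.2 with hle | hle
    · exact hanti hP hQ hne ⟨hPQ.le, hle⟩
    · exact hanti hQ hP (Ne.symm hne) ⟨hPQ.ge, hle⟩
  obtain ⟨U, hU, hUcard⟩ := Finset.exists_subset_card_eq (s := T.image Prod.fst) (n := 4)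
    (by rw [Finset.card_image_of_injOn hinj]; exact hcard)
  set g := U.orderEmbOfFin hUcard
  have hg : ∀ i, ∃ P ∈ T, P.1 = g i := fun i => by
    simpa using Finset.mem_image.1 (hU (U.orderEmbOfFin_mem hUcard i))
  choose P hPT hP using hg
  have hlt : ∀ i j, i < j → (P i).1 < (P j).1 ∧ (P j).2 < (P i).2 := by
    intro i j hij
    have h1 : (P i).1 < (P j).1 := by rw [hP, hP]; exact g.strictMono hij
    refine ⟨h1, ?_⟩
    by_contra! h2
    exact hanti (hPT i) (hPT j) (fun e => by simp [e] at h1) ⟨h1.le, h2⟩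
  have hA := fun i => hT (hPT i)
  have e1 := h.decreasing' hγ (hA 0) (hA 1) (hA 2) (hlt 0 1 (by decide)).2 (hlt 1 2 (by decide)).2
    (hlt 1 2 (by decide)).1
  have e2 := h.decreasing' hγ (hA 0) (hA 1) (hA 3) (hlt 0 1 (by decide)).2 (hlt 1 3 (by decide)).2
    (hlt 1 3 (by decide)).1
  have := (hlt 2 3 (by decide)).1
  omega

end

lemma exists_chain_of_card {ι : Type*} [PartialOrder ι] {s k : ℕ} {A : Finset ι}
    (hanti : ∀ T ⊆ A, IsAntichain (· ≤ ·) (T : Set ι) → T.card ≤ s) (hA : s * k < A.card) :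
    ∃ p : ℕ → ι, (∀ i ≤ k, p i ∈ A) ∧ ∀ i < k, p i < p (i + 1) := by
  classical
  induction k generalizing A with
  | zero =>
    obtain ⟨a, ha⟩ := Finset.card_pos.1 (by simpa using hA)
    exact ⟨fun _ => a, fun _ _ => ha, fun i hi => absurd hi (Nat.not_lt_zero i)⟩
  | succ k ih =>
    set M := A.filter fun a => ∀ b ∈ A, ¬ b < a with hM
    have hMA : M ⊆ A := Finset.filter_subset _ _
    have hMcard : M.card ≤ s := by
      refine hanti M hMA fun a ha b hb hne hle => ?_
      exact (Finset.mem_filter.1 hb).2 a (hMA ha) (lt_of_le_of_ne hle hne)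
    have hsub : A \ M ⊆ A := Finset.sdiff_subset
    obtain ⟨p, hp, hlt⟩ := ih (A := A \ M) (fun T hT => hanti T (hT.trans hsub)) (by
      have := Finset.card_sdiff_add_card_eq_card hMA
      rw [mul_add, mul_one] at hA
      omega)
    have hp0 := Finset.mem_sdiff.1 (hp 0 (Nat.zero_le _))
    obtain ⟨b, hb, hb0⟩ : ∃ b ∈ A, b < p 0 := by
      by_contra! hcon
      exact hp0.2 (Finset.mem_filter.2 ⟨hp0.1, hcon⟩)
    refine ⟨fun i => Nat.casesOn i b p, fun i hi => ?_, fun i hi => ?_⟩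
    · cases i with
      | zero => exact hb
      | succ i => exact hsub (hp i (by omega))
    · cases i with
      | zero => exact hb0
      | succ i => exact hlt i (by omega)

lemma NoTriangle.card_le {γ : ℝ} {A : Finset (ℕ × ℕ)} (hγ : 2 ≤ γ) (h : NoTriangle γ A) :
    A.card ≤ 60 := by
  by_contra! hcard
  obtain ⟨p, hp, hlt⟩ := exists_chain_of_card (k := 20)
    (fun T hT hanti => h.card_antichain_le hγ hT hanti) hcard
  have h2 : ∀ i, i + 2 ≤ 20 → (p i).1 < (p (i + 2)).1 ∧ (p i).2 < (p (i + 2)).2 := by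
    intro i hi
    have l1 := Prod.lt_iff.1 (hlt i (by omega))
    have l2 : p (i + 1) < p (i + 2) := hlt (i + 1) (by omega)
    rw [Prod.lt_iff] at l2
    constructor
    · by_contra! hle
      exact h.column hγ (hp i (by omega)) (hp (i + 2) hi) (Q := p (i + 1)) (by omega) (by omega)
        (by omega) (by omega)
    · by_contra! hle
      exact h.row hγ (hp i (by omega)) (hp (i + 2) hi) (Q := p (i + 1)) (by omega) (by omega)
        (by omega) (by omega)
  have h4 : ∀ i, i < 5 → (p (4 * i)).1 + 2 ≤ (p (4 * (i + 1))).1 ∧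
      (p (4 * i)).2 + 2 ≤ (p (4 * (i + 1))).2 := by
    intro i hi
    have l1 := h2 (4 * i) (by omega)
    have l2 := h2 (4 * i + 2) (by omega)
    rw [show 4 * (i + 1) = 4 * i + 2 + 2 by ring]
    omega
  set q : ℕ → ℕ × ℕ := fun i => p (4 * i) with hq
  have hqA : ∀ i ≤ 5, q i ∈ A := fun i hi => hp _ (by omega)
  have hmono : ∀ d i, i + (d + 1) ≤ 5 → (q i).1 + 2 ≤ (q (i + (d + 1))).1 ∧
      (q i).2 + 2 ≤ (q (i + (d + 1))).2 := by
    intro d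
    induction d with
    | zero => intro i hi; exact h4 i (by omega)
    | succ d ih =>
      intro i hi
      have l1 := ih i (by omega)
      have l2 := h4 (i + (d + 1)) (by omega)
      simp only [hq] at *
      rw [show i + (d + 1 + 1) = i + (d + 1) + 1 by ring]
      omega
  have hlt' : ∀ i j, i < j → j ≤ 5 → (q i).1 + 2 ≤ (q j).1 ∧ (q i).2 + 2 ≤ (q j).2 := by
    intro i j hij hj
    have := hmono (j - i - 1) i (by omega)
    rwa [show i + (j - i - 1 + 1) = j by omega] at this
  have hclose : ∀ i j, 0 < i → i < j → j ≤ 5 →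
      (q i).2 + (q j).1 < (q j).2 + (q i).1 + 2 ∧ (q i).1 + (q j).2 < (q j).1 + (q i).2 + 2 := by
    intro i j hi hij hj
    have l1 := hlt' 0 i hi (by omega)
    have l2 := hlt' i j hij hj
    exact ⟨h.increasing hγ (hqA 0 (by omega)) (hqA i (by omega)) (hqA j hj) (by omega) (by omega)
      l1.2, h.increasing' hγ (hqA 0 (by omega)) (hqA i (by omega)) (hqA j hj) (by omega) (by omega)
      l1.1⟩
  have hcol : ∀ i j l, i < j → j < l → l ≤ 5 →
      ¬ ((q i).2 + (q j).1 = (q j).2 + (q i).1 ∧ (q j).2 + (q l).1 = (q l).2 + (q j).1) := by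
    rintro i j l hij hjl hl ⟨e1, e2⟩
    have l1 := hlt' i j hij (by omega)
    have l2 := hlt' j l hjl hl
    exact h.collinear hγ (hqA i (by omega)) (hqA l hl) (by omega) (by omega) e1 e2
  have c12 := hclose 1 2 (by omega) (by omega) (by omega)
  have c13 := hclose 1 3 (by omega) (by omega) (by omega)
  have c14 := hclose 1 4 (by omega) (by omega) (by omega)
  have c15 := hclose 1 5 (by omega) (by omega) (by omega)
  have c23 := hclose 2 3 (by omega) (by omega) (by omega)
  have c24 := hclose 2 4 (by omega) (by omega) (by omega)
  have c25 := hclose 2 5 (by omega) (by omega) (by omega)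
  have c34 := hclose 3 4 (by omega) (by omega) (by omega)
  have c35 := hclose 3 5 (by omega) (by omega) (by omega)
  have c45 := hclose 4 5 (by omega) (by omega) (by omega)
  have d123 := hcol 1 2 3 (by omega) (by omega) (by omega)
  have d124 := hcol 1 2 4 (by omega) (by omega) (by omega)
  have d125 := hcol 1 2 5 (by omega) (by omega) (by omega)
  have d134 := hcol 1 3 4 (by omega) (by omega) (by omega)
  have d135 := hcol 1 3 5 (by omega) (by omega) (by omega)
  have d145 := hcol 1 4 5 (by omega) (by omega) (by omega)
  have d234 := hcol 2 3 4 (by omega) (by omega) (by omega)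
  have d235 := hcol 2 3 5 (by omega) (by omega) (by omega)
  have d245 := hcol 2 4 5 (by omega) (by omega) (by omega)
  have d345 := hcol 3 4 5 (by omega) (by omega) (by omega)
  omega

lemma IsEmptyPolygonIn.notMem_convexHull {S X : Set (ℝ × ℝ)} (h : IsEmptyPolygonIn S X)
    {z : ℝ × ℝ} (hz : z ∈ S) : z ∉ convexHull ℝ (X \ {z}) := by
  intro hmem
  by_cases hX : z ∈ X
  · exact h.2.1 z hX hmem
  · exact hX (h.2.2 ▸ ⟨convexHull_mono Set.sdiff_subset hmem, hz⟩)

lemma ncard_le_of_pow_eq {α β : ℝ} (hα : 1 < α) (hβ : 1 < β) {p q : ℕ} (hp : 0 < p) (hq : 0 < q)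
    (hpq : β ^ q = α ^ p) (h2 : 2 ≤ α ^ p) {X : Set (ℝ × ℝ)} (hXfin : X.Finite)
    (hX : IsEmptyPolygonIn (expLattice2 α β) X) : X.ncard ≤ 60 * (p * q) := by
  classical
  set pt : ℕ × ℕ → ℝ × ℝ := fun v => (α ^ v.1, β ^ v.2) with hpt
  have hinj : Function.Injective pt := by
    intro u v huv
    exact Prod.ext (pow_right_injective₀ (by linarith) hα.ne' (congrArg Prod.fst huv))
      (pow_right_injective₀ (by linarith) hβ.ne' (congrArg Prod.snd huv))
  have hfin : (pt ⁻¹' X).Finite := hXfin.preimage hinj.injOn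
  set I : Finset (ℕ × ℕ) := hfin.toFinset with hI
  have hIX : ∀ v, v ∈ I ↔ pt v ∈ X := fun v => by simp [hI]
  have hcard : X.ncard = I.card := by
    have : X = pt '' (I : Set (ℕ × ℕ)) := by
      ext z
      constructor
      · intro hz
        obtain ⟨m, n, rfl⟩ := hX.1 hz
        exact ⟨(m, n), (hIX (m, n)).2 hz, rfl⟩
      · rintro ⟨v, hv, rfl⟩
        exact (hIX v).1 hv
    rw [this, Set.ncard_image_of_injective _ hinj, Set.ncard_coe_finset]
  set res : ℕ × ℕ → ℕ × ℕ := fun v => (v.1 % p, v.2 % q) with hres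
  have himg : (I.image res).card ≤ p * q := by
    calc _ ≤ (Finset.range p ×ˢ Finset.range q).card := Finset.card_le_card fun v hv => by
          obtain ⟨u, -, rfl⟩ := Finset.mem_image.1 hv
          simp [hres, Nat.mod_lt _ hp, Nat.mod_lt _ hq]
      _ = p * q := by simp
  rw [hcard]
  refine (Finset.card_le_mul_card_image I 60 fun w hw => ?_).trans (Nat.mul_le_mul_left _ himg)
  set B := I.filter fun v => res v = w with hB
  set quo : ℕ × ℕ → ℕ × ℕ := fun v => (v.1 / p, v.2 / q) with hquo
  have hrec : ∀ v ∈ B, v = (w.1 + p * (quo v).1, w.2 + q * (quo v).2) := by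
    intro v hv
    have := (Finset.mem_filter.1 hv).2
    rw [← this]
    exact Prod.ext (Nat.mod_add_div _ _).symm (Nat.mod_add_div _ _).symm
  have hquoinj : Set.InjOn quo (B : Set (ℕ × ℕ)) := by
    intro u hu v hv huv
    rw [hrec u hu, hrec v hv, huv]
  rw [← Finset.card_image_of_injOn hquoinj]
  refine NoTriangle.card_le h2 ?_
  have hmem : ∀ P ∈ B.image quo, (w.1 + p * P.1, w.2 + q * P.2) ∈ I := by
    intro P hP
    obtain ⟨v, hv, rfl⟩ := Finset.mem_image.1 hP
    rw [← hrec v hv]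
    exact (Finset.mem_filter.1 hv).1
  intro z P hP Q hQ R hR hPz hQz hRz a b c ha hb hc habc e1 e2
  set g : ℕ × ℕ → ℝ × ℝ := fun v => pt (w.1 + p * v.1, w.2 + q * v.2) with hg
  have hginj : Function.Injective g := by
    intro u v huv
    have := hinj huv
    simp only [Prod.mk.injEq, add_right_inj, mul_eq_mul_left_iff, hp.ne', hq.ne', or_false] at this
    exact Prod.ext this.1 this.2
  have hgX : ∀ v ∈ B.image quo, v ≠ z → g v ∈ convexHull ℝ (X \ {g z}) := fun v hv hvz =>
    subset_convexHull ℝ _ ⟨(hIX _).1 (hmem v hv), fun e => hvz (hginj e)⟩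
  refine hX.notMem_convexHull (z := g z) ⟨_, _, rfl⟩ ?_
  have hgz : a • g P + b • g Q + c • g R = g z := by
    have hgv : ∀ v, g v = (α ^ w.1 * (α ^ p) ^ v.1, β ^ w.2 * (α ^ p) ^ v.2) := by
      intro v
      simp only [hg, hpt, pow_add, pow_mul, hpq]
    simp only [hgv, Prod.smul_mk, Prod.mk_add_mk, smul_eq_mul, ← e1, ← e2]
    exact Prod.ext (by ring) (by ring)
  have hconv := convex_convexHull ℝ (X \ {g z})
  have := hconv.sum_mem (t := Finset.univ) (w := ![a, b, c]) (z := ![g P, g Q, g R])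
    (by intro i _; fin_cases i <;> simpa) (by simp [Fin.sum_univ_three, habc])
    (by
      intro i _
      fin_cases i
      · exact hgX P hP hPz
      · exact hgX Q hQ hQz
      · exact hgX R hR hRz)
  rw [Fin.sum_univ_three] at this
  exact hgz ▸ this

theorem helly_finite_iff_rational_log (α β : ℝ) (hα : 1 < α) (hβ : 1 < β) :
    (∃ N : ℕ, ∀ X : Set (ℝ × ℝ), X.Finite → IsEmptyPolygonIn (expLattice2 α β) X →
      X.ncard ≤ N) ↔
    (∃ p q : ℕ, 0 < p ∧ 0 < q ∧ β ^ q = α ^ p) := by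
  refine ⟨fun ⟨N, hN⟩ => exists_of_ncard_le hα hβ hN, ?_⟩
  rintro ⟨p, q, hp, hq, hpq⟩
  obtain ⟨k, hk⟩ := pow_unbounded_of_one_lt 2 (one_lt_pow₀ hα hp.ne')
  have hk0 : 0 < k := by
    rcases Nat.eq_zero_or_pos k with rfl | h
    · norm_num at hk
    · exact h
  refine ⟨60 * (p * k * (q * k)), fun X hXfin hX => ?_⟩
  exact ncard_le_of_pow_eq hα hβ (Nat.mul_pos hp hk0) (Nat.mul_pos hq hk0)
    (by rw [pow_mul, pow_mul, hpq]) (by rw [pow_mul]; exact hk.le) hXfin hX
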